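/- Let m, n ≥ 1, M = mn, M₃ = 3M − 1, N = m²n + mn², let A ∈ ℝ^{M₃×N}, b ∈ ℝ^{M₃}, c ∈ ℝ^N be the data of the reduced OT linear program built from histograms μ¹, μ² (nonnegative with total mass 1 each), and let σ > 0. Define the HOT iteration: given w⁰ = (y⁰, z⁰, x⁰), for k ≥ 0 set ȳᵏ = (A Aᵀ)⁻¹( b/σ − A(xᵏ/σ + zᵏ − c) ), x̄ᵏ = xᵏ + σ(Aᵀ ȳᵏ + zᵏ − c), z̄ᵏ = Π_{ℝ₊^N}( c − Aᵀ ȳᵏ − x̄ᵏ/σ ), and wᵏ⁺¹ = (1/(k+2)) w⁰ + ((k+1)/(k+2)) (2 w̄ᵏ − wᵏ), where w̄ᵏ = (ȳᵏ, z̄ᵏ, x̄ᵏ). Then the sequence {w̄ᵏ} converges to some w* = (y*, z*, x*) satisfying the KKT conditions Aᵀ y* + z* = c, A x* = b, x* ≥ 0, z* ≥ 0, ⟨x*, z*⟩ = 0; in particular x* is an optimal solution of min { ⟨c, x⟩ : A x = b, x ≥ 0 } and (y*, z*) is an optimal solution of min { −⟨b, y⟩ : Aᵀ y + z = c, z ≥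 0 }. -/

import Mathlib

open Matrix Finset Filter Topology

noncomputable section

/-- The bijection between row indices `r ∈ Fin (nm − 1)` and pairs
`(l,k) ∈ Fin n × Fin m` (with `k` the inner/fast index): `r ↦ (r / m, r % m)`. -/
def rowIdx (m n : ℕ) (hm : 0 < m) (r : Fin (n * m - 1)) : Fin n × Fin m :=
  (⟨r.1 / m, (Nat.div_lt_iff_lt_mul hm).mpr (lt_of_lt_of_le r.2 (Nat.sub_le _ _))⟩,
   ⟨r.1 % m, Nat.mod_lt _ hm⟩)

/-- The constraint matrix `A = [[A₁, A₂], [A₃, 0], [0, A₄]] ∈ ℝ^{M₃ × N}` of the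
reduced OT model (`M = mn`, `M₃ = 3M − 1`, `N = m²n + mn²`) with
`A₁ = I_M ⊗ 1ₘᵀ`, `A₂ = −1ₙᵀ ⊗ I_M`, `A₃ = Iₙ ⊗ (1ₘᵀ ⊗ Iₘ)`,
`A₄ = diag(1ₙᵀ ⊗ Iₘ, …, 1ₙᵀ ⊗ Iₘ, 1ₙᵀ ⊗ Īₘ)`.  Columns: `f⁽¹⁾`-triples `(j,k,i)`
and `f⁽²⁾`-triples `(l,j,k)`; row blocks: bins `(j,k)`, bins `(j,i)`, pairs `(l,k)`
with the last pair deleted. -/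
def Amat (m n : ℕ) (hm : 0 < m) :
    Matrix ((Fin n × Fin m) ⊕ (Fin n × Fin m) ⊕ Fin (n * m - 1))
      ((Fin n × Fin m × Fin m) ⊕ (Fin n × Fin n × Fin m)) ℝ :=
  Matrix.of fun r c =>
    match r, c with
    | .inl p, .inl c1 => if p.1 = c1.1 ∧ p.2 = c1.2.1 then 1 else 0
    | .inl p, .inr c2 => if p.1 = c2.2.1 ∧ p.2 = c2.2.2 then -1 else 0
    | .inr (.inl p), .inl c1 => if p.1 = c1.1 ∧ p.2 = c1.2.2 then 1 else 0
    | .inr (.inl _), .inr _ => 0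
    | .inr (.inr _), .inl _ => 0
    | .inr (.inr r), .inr c2 =>
        if (rowIdx m n hm r).1 = c2.1 ∧ (rowIdx m n hm r).2 = c2.2.2 then 1 else 0

/-- The right-hand side `b = (0_M; μ¹; Ī_M μ²) ∈ ℝ^{M₃}`. -/
def bvec (m n : ℕ) (hm : 0 < m) (μ1 μ2 : Fin n × Fin m → ℝ) :
    (Fin n × Fin m) ⊕ (Fin n × Fin m) ⊕ Fin (n * m - 1) → ℝ :=
  Sum.elim (0 : Fin n × Fin m → ℝ) (Sum.elim μ1 (fun r => μ2 (rowIdx m n hm r)))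

/-- The cost vector `c = (c¹; c²) ∈ ℝ^N` with `c¹_{i,k,j} = (k−i)²` (at the
`f⁽¹⁾`-column `(j,k,i)`) and `c²_{k,j,l} = (j−l)²` (at the `f⁽²⁾`-column `(l,j,k)`). -/
def cvec (m n : ℕ) : (Fin n × Fin m × Fin m) ⊕ (Fin n × Fin n × Fin m) → ℝ :=
  Sum.elim (fun q => (((q.2.1 : ℕ) : ℝ) - ((q.2.2 : ℕ) : ℝ)) ^ 2)
    (fun q => (((q.2.1 : ℕ) : ℝ) - ((q.1 : ℕ) : ℝ)) ^ 2)

/-- The **Farkas lemma** for finitely many linear functionals on an arbitrary real vector space. -/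
theorem farkas_of_forall_nonneg {V : Type*} [AddCommGroup V] [Module ℝ V] {k : ℕ}
    (a : Fin k → V →ₗ[ℝ] ℝ) (f : V →ₗ[ℝ] ℝ) (h : ∀ v, (∀ i, 0 ≤ a i v) → 0 ≤ f v) :
    ∃ l : Fin k → ℝ, (∀ i, 0 ≤ l i) ∧ f = ∑ i, l i • a i := by
  induction k generalizing f with
  | zero =>
    refine ⟨fun _ => 0, fun _ => le_rfl, LinearMap.ext fun v => ?_⟩
    have h1 := h v (fun i => i.elim0)
    have h2 := h (-v) (fun i => i.elim0)
    simp only [map_neg] at h2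
    simp only [univ_eq_empty, sum_empty, LinearMap.zero_apply]
    linarith
  | succ k ih =>
    by_cases hlast : ∀ v, (∀ i : Fin k, 0 ≤ a i.castSucc v) → 0 ≤ f v
    · obtain ⟨l, hl, hf⟩ := ih (fun i => a i.castSucc) f hlast
      refine ⟨Fin.snoc l 0, fun i => ?_, ?_⟩
      · refine Fin.lastCases ?_ (fun j => ?_) i
        · simp
        · simpa using hl j
      · rw [Fin.sum_univ_castSucc]
        simpa using hf
    · push Not at hlast
      obtain ⟨w, hw, hfw⟩ := hlast
      have haw : a (Fin.last k) w < 0 := by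
        by_contra! hc
        exact hfw.not_ge (h w fun i => Fin.lastCases hc hw i)
      set t : ℝ := -a (Fin.last k) w with ht
      have htpos : 0 < t := by linarith
      -- replace `v` by its shift along `w` into the kernel of the last functional
      let π : V →ₗ[ℝ] V := LinearMap.id + (t⁻¹ • a (Fin.last k)).smulRight w
      have hπ : ∀ (g : V →ₗ[ℝ] ℝ) v, g (π v) = g v + t⁻¹ * a (Fin.last k) v * g w := by
        intro g v; simp [π]
      obtain ⟨l, hl, hf⟩ := ih (fun i => (a i.castSucc).comp π) (f.comp π) (fun v hv => by
        refine h (π v) fun i => Fin.lastCases ?_ hv i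
        rw [hπ, show a (Fin.last k) w = -t by simp [ht]]
        field_simp
        simp)
      refine ⟨Fin.snoc l (t⁻¹ * (∑ i, l i * a i.castSucc w - f w)), fun i => ?_, ?_⟩
      · refine Fin.lastCases ?_ (fun j => ?_) i
        · have := Finset.sum_nonneg (s := univ) fun i _ => mul_nonneg (hl i) (hw i)
          simp only [Fin.snoc_last]
          exact mul_nonneg (inv_nonneg.2 htpos.le) (by linarith)
        · simpa using hl j
      · ext v
        have := LinearMap.congr_fun hf v
        simp only [LinearMap.comp_apply, hπ, LinearMap.coe_sum, Finset.sum_apply,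
          LinearMap.smul_apply, smul_eq_mul, mul_add, sum_add_distrib] at this
        have e : ∑ i, l i * (t⁻¹ * a (Fin.last k) v * a i.castSucc w) =
            t⁻¹ * a (Fin.last k) v * ∑ i, l i * a i.castSucc w := by
          rw [mul_sum]; exact sum_congr rfl fun i _ => by ring
        rw [e] at this
        rw [Fin.sum_univ_castSucc]
        simp only [Fin.snoc_castSucc, Fin.snoc_last, LinearMap.add_apply, LinearMap.coe_sum,
          Finset.sum_apply, LinearMap.smul_apply, smul_eq_mul]
        linear_combination this

theorem farkas_of_fintype {V ι : Type*} [AddCommGroup V] [Module ℝ V] [Fintype ι]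
    (a : ι → V →ₗ[ℝ] ℝ) (f : V →ₗ[ℝ] ℝ) (h : ∀ v, (∀ i, 0 ≤ a i v) → 0 ≤ f v) :
    ∃ l : ι → ℝ, (∀ i, 0 ≤ l i) ∧ f = ∑ i, l i • a i := by
  let e := Fintype.equivFin ι
  obtain ⟨l, hl, hf⟩ := farkas_of_forall_nonneg (a ∘ e.symm) f fun v hv =>
    h v fun i => by simpa using hv (e i)
  refine ⟨l ∘ e, fun i => hl _, hf.trans ?_⟩
  exact (Fintype.sum_equiv e _ _ fun i => by simp).symm

theorem exists_primal_minimizer {R C : Type*} [Fintype R] [Fintype C]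
    (A : Matrix R C ℝ) (b : R → ℝ) (c : C → ℝ)
    (hfeas : ∃ x, A *ᵥ x = b ∧ ∀ i, 0 ≤ x i) (hbdd : ∃ v, Aᵀ *ᵥ v = 1) :
    ∃ x, A *ᵥ x = b ∧ (∀ i, 0 ≤ x i) ∧
      ∀ x', A *ᵥ x' = b → (∀ i, 0 ≤ x' i) → c ⬝ᵥ x ≤ c ⬝ᵥ x' := by
  obtain ⟨v, hv⟩ := hbdd
  let S : Set (C → ℝ) := {x | A *ᵥ x = b ∧ ∀ i, 0 ≤ x i}
  have hsub : S ⊆ Set.Icc 0 (fun _ => v ⬝ᵥ b) := fun x hx => by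
    have htotal : ∑ i, x i = v ⬝ᵥ b := by
      rw [← hx.1, dotProduct_mulVec, ← mulVec_transpose, hv, one_dotProduct]
    exact ⟨hx.2, fun i => htotal ▸ single_le_sum (fun j _ => hx.2 j) (mem_univ i)⟩
  have hclosed : IsClosed S := by
    refine (isClosed_eq (by fun_prop) continuous_const).inter ?_
    exact isClosed_Ici (a := (0 : C → ℝ))
  have hcompact : IsCompact S := isCompact_Icc.of_isClosed_subset hclosed hsub
  obtain ⟨x, hx, hmin⟩ := hcompact.exists_isMinOn hfeas
    (f := fun x => c ⬝ᵥ x) (by fun_prop)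
  exact ⟨x, hx.1, hx.2, fun x' h1 h2 => hmin ⟨h1, h2⟩⟩

theorem exists_kkt {R C : Type*} [Fintype R] [Fintype C]
    (A : Matrix R C ℝ) (b : R → ℝ) (c : C → ℝ)
    (hfeas : ∃ x, A *ᵥ x = b ∧ ∀ i, 0 ≤ x i) (hbdd : ∃ v, Aᵀ *ᵥ v = 1) :
    ∃ y z x, Aᵀ *ᵥ y + z = c ∧ A *ᵥ x = b ∧ (∀ i, 0 ≤ x i) ∧ (∀ i, 0 ≤ z i) ∧
      ∀ i, x i = 0 ∨ z i = 0 := by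
  classical
  obtain ⟨x, hx, hx0, hmin⟩ := exists_primal_minimizer A b c hfeas hbdd
  let row : R → (C → ℝ) →ₗ[ℝ] ℝ := fun r => (LinearMap.proj r).comp A.mulVecLin
  -- the feasible directions at `x` satisfy `A d = 0` and `d i ≥ 0` wherever `x i = 0`
  let a : R ⊕ R ⊕ {i // x i = 0} → (C → ℝ) →ₗ[ℝ] ℝ :=
    Sum.elim row (Sum.elim (fun r => -row r) fun i => LinearMap.proj i.1)
  obtain ⟨l, hl, hc⟩ := farkas_of_fintype a (dotProductBilin ℝ ℝ c) (fun d hd => by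
    have hA : A *ᵥ d = 0 := by
      ext r
      have h1 := hd (.inl r)
      have h2 := hd (.inr (.inl r))
      simp [a, row] at h1 h2
      exact le_antisymm h2 h1
    have hev : ∀ᶠ t : ℝ in 𝓝[>] 0, ∀ i, 0 ≤ x i + t * d i := by
      refine eventually_all.2 fun i => ?_
      rcases (hx0 i).eq_or_lt with h0 | hpos
      · have hdi : 0 ≤ d i := hd (.inr (.inr ⟨i, h0.symm⟩))
        filter_upwards [self_mem_nhdsWithin] with t ht
        exact add_nonneg (hx0 i) (mul_nonneg (le_of_lt ht) hdi)
      · have hcont : Tendsto (fun t : ℝ => x i + t * d i) (𝓝 0) (𝓝 (x i)) := by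
          have : Continuous fun t : ℝ => x i + t * d i := by fun_prop
          simpa using this.tendsto 0
        exact ((hcont.eventually_const_lt hpos).filter_mono nhdsWithin_le_nhds).mono
          fun t ht => ht.le
    obtain ⟨t, ht, htpos⟩ := (hev.and self_mem_nhdsWithin).exists
    have := hmin (x + t • d) (by rw [mulVec_add, mulVec_smul, hA, smul_zero, add_zero, hx]) ht
    rw [dotProduct_add, dotProduct_smul, smul_eq_mul] at this
    change 0 ≤ c ⬝ᵥ d
    exact nonneg_of_mul_nonneg_right (a := t) (by linarith) htpos)
  let z : C → ℝ := fun i => if h : x i = 0 then l (.inr (.inr ⟨i, h⟩)) else 0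
  refine ⟨fun r => l (.inl r) - l (.inr (.inl r)), z, x, ?_, hx, hx0, fun i => ?_, fun i => ?_⟩
  · ext j
    have hj := LinearMap.congr_fun hc (Pi.single j 1)
    have hz : ∑ i : {i // x i = 0}, l (.inr (.inr i)) * (Pi.single j 1 : C → ℝ) i = z j := by
      by_cases h : x j = 0
      · rw [sum_eq_single ⟨j, h⟩]
        · simp [z, h]
        · intro i _ hij
          rw [Pi.single_eq_of_ne (fun hh => hij (Subtype.ext hh)), mul_zero]
        · simp
      · rw [show z j = 0 by simp [z, h]]
        refine sum_eq_zero fun i _ => ?_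
        rw [Pi.single_eq_of_ne (fun hh : (i : C) = j => h (hh ▸ i.2)), mul_zero]
    simp only [Fintype.sum_sum_type] at hj
    simp [a, row] at hj
    rw [hz] at hj
    rw [hj]
    simp [mulVec, dotProduct, mul_sub, mul_comm, sum_sub_distrib]
    ring
  · by_cases h : x i = 0 <;> simp [z, h, hl]
  · by_cases h : x i = 0 <;> simp [z, h]

theorem tendsto_zero_of_weighted_recursion {e β : ℕ → ℝ} {p : ℝ} (hp : 0 < p)
    (he : ∀ k, 0 ≤ e k) (hβ : Tendsto β atTop (𝓝 0))
    (h : ∀ k : ℕ, ((k : ℝ) + p + 1) * e (k + 1) ≤ ((k : ℝ) + p) * e k + β k) :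
    Tendsto e atTop (𝓝 0) := by
  have hsum : ∀ k : ℕ, ((k : ℝ) + p) * e k ≤ p * e 0 + ∑ i ∈ range k, β i := by
    intro k
    induction k with
    | zero => simp
    | succ k ih =>
      rw [sum_range_succ]
      push_cast
      linarith [h k]
  have hbound : ∀ᶠ k : ℕ in atTop,
      e k ≤ (k : ℝ)⁻¹ * (p * e 0) + (k : ℝ)⁻¹ * ∑ i ∈ range k, β i := by
    filter_upwards [eventually_gt_atTop 0] with k hk
    have hk' : (0 : ℝ) < k := by exact_mod_cast hk
    rw [← mul_add, inv_mul_eq_div, le_div_iff₀ hk']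
    nlinarith [hsum k, he k]
  refine squeeze_zero' (Eventually.of_forall he) hbound ?_
  simpa using (tendsto_inv_atTop_nhds_zero_nat.mul_const (p * e 0)).add hβ.cesaro

section Halpern

variable {E : Type*} [NormedAddCommGroup E] [InnerProductSpace ℝ E]

theorem LipschitzWith.convex_fixedPoints {R : E → E} (hR : LipschitzWith 1 R) :
    Convex ℝ (Function.fixedPoints R) := by
  intro p hp q hq a b ha hb hab
  obtain rfl : a = 1 - b := by linarith
  have hm : (1 - b) • p + b • q = AffineMap.lineMap p q b := by
    rw [AffineMap.lineMap_apply_module]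
  rw [hm]
  set x : E := AffineMap.lineMap p q b
  have h1 : dist p (R x) ≤ b * dist p q := by
    calc dist p (R x) = dist (R p) (R x) := by rw [hp.eq]
      _ ≤ dist p x := by simpa using hR.dist_le_mul p x
      _ = b * dist p q := by rw [dist_left_lineMap, Real.norm_of_nonneg hb]
  have h2 : dist (R x) q ≤ (1 - b) * dist p q := by
    calc dist (R x) q = dist (R x) (R q) := by rw [hq.eq]
      _ ≤ dist x q := by simpa using hR.dist_le_mul x q
      _ = (1 - b) * dist p q := by rw [dist_lineMap_right, Real.norm_of_nonneg ha]
  have h3 := dist_triangle p (R x) q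
  exact eq_lineMap_of_dist_eq_mul_of_dist_eq_mul (by linarith) (by linarith)

variable {R : E → E} {s : ℕ → E}

theorem halpern_dist_le (hR : LipschitzWith 1 R)
    (hs : ∀ k : ℕ, s (k + 1) =
      (1 / ((k : ℝ) + 2)) • s 0 + (((k : ℝ) + 1) / ((k : ℝ) + 2)) • R (s k))
    {p : E} (hp : R p = p) (k : ℕ) : ‖s k - p‖ ≤ ‖s 0 - p‖ := by
  induction k with
  | zero => exact le_rfl
  | succ k ih =>
    have hk : (0 : ℝ) < (k : ℝ) + 2 := by positivity
    have e : s (k + 1) - p = (1 / ((k : ℝ) + 2)) • (s 0 - p) +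
        (((k : ℝ) + 1) / ((k : ℝ) + 2)) • (R (s k) - p) := by
      rw [hs]
      match_scalars <;> field_simp
      ring
    have hRk : ‖R (s k) - p‖ ≤ ‖s 0 - p‖ := by
      have := hR.norm_sub_le (s k) p
      rw [hp] at this
      simpa using this.trans (by simpa using ih)
    rw [e]
    refine (norm_add_le _ _).trans ?_
    rw [norm_smul, norm_smul, Real.norm_of_nonneg (by positivity),
      Real.norm_of_nonneg (by positivity)]
    calc _ ≤ 1 / ((k : ℝ) + 2) * ‖s 0 - p‖ + ((k : ℝ) + 1) / ((k : ℝ) + 2) * ‖s 0 - p‖ := by gcongr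
      _ = ‖s 0 - p‖ := by field_simp; ring

theorem halpern_step_tendsto_zero (hR : LipschitzWith 1 R)
    (hs : ∀ k : ℕ, s (k + 1) =
      (1 / ((k : ℝ) + 2)) • s 0 + (((k : ℝ) + 1) / ((k : ℝ) + 2)) • R (s k))
    {p : E} (hp : R p = p) : Tendsto (fun k => ‖s (k + 1) - s k‖) atTop (𝓝 0) := by
  have hB : ∀ k, ‖s 0 - R (s k)‖ ≤ 2 * ‖s 0 - p‖ := fun k => by
    have h1 := hR.norm_sub_le (s k) p
    have h2 := halpern_dist_le hR hs hp k
    have h3 := norm_sub_le_norm_sub_add_norm_sub (s 0) p (R (s k))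
    rw [hp] at h1
    rw [norm_sub_rev p] at h3
    simp only [NNReal.coe_one, one_mul] at h1
    linarith
  have hrec : ∀ k : ℕ, ((k : ℝ) + 2 + 1) * ‖s (k + 1 + 1) - s (k + 1)‖ ≤
      ((k : ℝ) + 2) * ‖s (k + 1) - s k‖ + (2 * ‖s 0 - p‖) * ((k : ℝ) + 2)⁻¹ := fun k => by
    have hk : (0 : ℝ) < (k : ℝ) + 2 := by positivity
    have hk3 : (0 : ℝ) < (k : ℝ) + 3 := by positivity
    have e : ((k : ℝ) + 2 + 1) • (s (k + 1 + 1) - s (k + 1)) =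
        ((k : ℝ) + 2) • (R (s (k + 1)) - R (s k)) - ((k : ℝ) + 2)⁻¹ • (s 0 - R (s k)) := by
      rw [hs (k + 1), hs k]
      push_cast
      rw [show (k : ℝ) + 1 + 2 = k + 3 by ring, show (k : ℝ) + 1 + 1 = k + 2 by ring]
      match_scalars <;> field_simp <;> ring
    have h1 := hR.norm_sub_le (s (k + 1)) (s k)
    simp only [NNReal.coe_one, one_mul] at h1
    calc ((k : ℝ) + 2 + 1) * ‖s (k + 1 + 1) - s (k + 1)‖
        = ‖((k : ℝ) + 2 + 1) • (s (k + 1 + 1) - s (k + 1))‖ := by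
          rw [norm_smul, Real.norm_of_nonneg (by positivity)]
      _ ≤ ((k : ℝ) + 2) * ‖R (s (k + 1)) - R (s k)‖ + ((k : ℝ) + 2)⁻¹ * ‖s 0 - R (s k)‖ := by
          rw [e]
          refine (norm_sub_le _ _).trans_eq ?_
          rw [norm_smul, norm_smul, Real.norm_of_nonneg (by positivity),
            Real.norm_of_nonneg (by positivity)]
      _ ≤ _ := by
          rw [mul_comm (2 * ‖s 0 - p‖)]
          gcongr
          exact hB k
  refine tendsto_zero_of_weighted_recursion two_pos (fun _ => norm_nonneg _) ?_ hrec
  have : Tendsto (fun k : ℕ => ((k : ℝ) + 2)⁻¹) atTop (𝓝 0) :=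
    (tendsto_atTop_add_const_right _ _ tendsto_natCast_atTop_atTop).inv_tendsto_atTop
  simpa using this.const_mul (2 * ‖s 0 - p‖)

theorem halpern_residual_tendsto_zero (hR : LipschitzWith 1 R)
    (hs : ∀ k : ℕ, s (k + 1) =
      (1 / ((k : ℝ) + 2)) • s 0 + (((k : ℝ) + 1) / ((k : ℝ) + 2)) • R (s k))
    {p : E} (hp : R p = p) : Tendsto (fun k => s k - R (s k)) atTop (𝓝 0) := by
  have hstep := tendsto_zero_iff_norm_tendsto_zero.2 (halpern_step_tendsto_zero hR hs hp)
  have hscaled : Tendsto (fun k : ℕ => ((k : ℝ) + 1)⁻¹ • (s 0 - s (k + 1))) atTop (𝓝 0) := by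
    have h1 : Tendsto (fun k : ℕ => ((k : ℝ) + 1)⁻¹) atTop (𝓝 0) :=
      (tendsto_atTop_add_const_right _ _ tendsto_natCast_atTop_atTop).inv_tendsto_atTop
    refine h1.zero_smul_isBoundedUnder_le ⟨2 * ‖s 0 - p‖, ?_⟩
    refine eventually_map.2 (Eventually.of_forall fun k => ?_)
    have h2 := halpern_dist_le hR hs hp (k + 1)
    have h3 := norm_sub_le_norm_sub_add_norm_sub (s 0) p (s (k + 1))
    rw [norm_sub_rev p] at h3
    simp only [Function.comp_apply]
    linarith
  have e : (fun k => s k - R (s k)) =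
      fun k : ℕ => ((k : ℝ) + 1)⁻¹ • (s 0 - s (k + 1)) - (s (k + 1) - s k) := by
    funext k
    have hk : (0 : ℝ) < (k : ℝ) + 1 := by positivity
    have hk2 : (0 : ℝ) < (k : ℝ) + 2 := by positivity
    rw [hs k]
    match_scalars <;> field_simp <;> ring
  rw [e]
  simpa using hscaled.sub hstep

open scoped InnerProductSpace in
/-- Halpern's iteration with weights `1 / (k + 2)` of a nonexpansive map with a fixed point
converges to a fixed point. -/
theorem halpern_tendsto [FiniteDimensional ℝ E] (hR : LipschitzWith 1 R)
    (hs : ∀ k : ℕ, s (k + 1) =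
      (1 / ((k : ℝ) + 2)) • s 0 + (((k : ℝ) + 1) / ((k : ℝ) + 2)) • R (s k))
    (hfix : ∃ p, R p = p) : ∃ p, R p = p ∧ Tendsto s atTop (𝓝 p) := by
  have hclosed : IsClosed (Function.fixedPoints R) := isClosed_fixedPoints hR.continuous
  obtain ⟨p, hp, hpmin⟩ := exists_norm_eq_iInf_of_complete_convex (K := Function.fixedPoints R)
    hfix hclosed.isComplete hR.convex_fixedPoints (s 0)
  have hvar := (norm_eq_iInf_iff_real_inner_le_zero hR.convex_fixedPoints hp).1 hpmin
  have hp' : R p = p := hp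
  refine ⟨p, hp', ?_⟩
  have hres := halpern_residual_tendsto_zero hR hs hp'
  have hcont : Continuous fun v => max ⟪s 0 - p, v - p⟫_ℝ 0 := by fun_prop
  have hlim : Tendsto (fun k => max ⟪s 0 - p, s k - p⟫_ℝ 0) atTop (𝓝 0) := by
    refine tendsto_of_subseq_tendsto fun ns hns => ?_
    obtain ⟨q, -, φ, hφ, hq⟩ := (isCompact_closedBall p ‖s 0 - p‖).tendsto_subseq
      (x := s ∘ ns) fun k => by simpa [dist_eq_norm] using halpern_dist_le hR hs hp' (ns k)
    refine ⟨φ, ?_⟩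
    have hq0 : R q = q := by
      have h1 := hres.comp (hns.comp hφ.tendsto_atTop)
      have h2 := hq.sub ((hR.continuous.tendsto q).comp hq)
      exact (sub_eq_zero.1 (tendsto_nhds_unique h2 h1)).symm
    have := (hcont.tendsto q).comp hq
    rwa [max_eq_right (hvar q hq0)] at this
  have hsq : Tendsto (fun k => ‖s k - p‖ ^ 2) atTop (𝓝 0) := by
    refine tendsto_zero_of_weighted_recursion (p := 1)
      (β := fun k => 2 * max ⟪s 0 - p, s (k + 1) - p⟫_ℝ 0) one_pos (fun _ => by positivity)
      (by simpa using ((tendsto_add_atTop_iff_nat 1).2 hlim).const_mul 2) fun k => ?_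
    have e : ((k : ℝ) + 2) • (s (k + 1) - p) = (s 0 - p) + ((k : ℝ) + 1) • (R (s k) - p) := by
      have hk : (0 : ℝ) < (k : ℝ) + 2 := by positivity
      rw [hs]
      match_scalars <;> field_simp
      ring
    have hRk : ‖R (s k) - p‖ ≤ ‖s k - p‖ := by
      simpa [hp'] using hR.norm_sub_le (s k) p
    -- pair the recursion with `s (k + 1) - p`
    have hin := congrArg (fun v => ⟪v, s (k + 1) - p⟫_ℝ) e
    simp only [inner_add_left, real_inner_smul_left, real_inner_self_eq_norm_sq] at hin
    have hcs : ⟪R (s k) - p, s (k + 1) - p⟫_ℝ ≤ ‖s k - p‖ * ‖s (k + 1) - p‖ :=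
      (real_inner_le_norm _ _).trans (by gcongr)
    have hmax := le_max_left ⟪s 0 - p, s (k + 1) - p⟫_ℝ 0
    have hk : (0 : ℝ) ≤ (k : ℝ) + 1 := by positivity
    nlinarith [mul_le_mul_of_nonneg_left hcs hk,
      mul_nonneg hk (sq_nonneg (‖s k - p‖ - ‖s (k + 1) - p‖))]
  rw [tendsto_iff_norm_sub_tendsto_zero]
  simpa using hsq.sqrt

end Halpern

section HOT

variable {R C : Type*} [Fintype R] [Fintype C] [DecidableEq R]

/-- The `y`-update of HOT as a function of the governing variable `s = x + σ z`. -/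
def hotY (A : Matrix R C ℝ) (b : R → ℝ) (c : C → ℝ) (σ : ℝ) (s : C → ℝ) : R → ℝ :=
  (A * Aᵀ)⁻¹ *ᵥ (σ⁻¹ • b - A *ᵥ (σ⁻¹ • s - c))

/-- The `x`-update of HOT as a function of the governing variable `s = x + σ z`. -/
def hotX (A : Matrix R C ℝ) (b : R → ℝ) (c : C → ℝ) (σ : ℝ) (s : C → ℝ) : C → ℝ :=
  s + σ • (Aᵀ *ᵥ hotY A b c σ s - c)

/-- The reflected operator `s ↦ 2 (x̄ + σ z̄) - s` of HOT; it is the composition of the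
reflection in an affine subspace and the componentwise absolute value. -/
def hotReflect (A : Matrix R C ℝ) (b : R → ℝ) (c : C → ℝ) (σ : ℝ) (s : C → ℝ) : C → ℝ :=
  fun i => |2 * hotX A b c σ s i - s i|

variable {A : Matrix R C ℝ} {b : R → ℝ} {c : C → ℝ} {σ : ℝ}

theorem continuous_hotY : Continuous (hotY A b c σ) := by
  unfold hotY; fun_prop

theorem continuous_hotX : Continuous (hotX A b c σ) := by
  have := continuous_hotY (A := A) (b := b) (c := c) (σ := σ)
  unfold hotX; fun_prop

theorem mulVec_hotX (hA : IsUnit (A * Aᵀ).det) (hσ : 0 < σ) (s : C → ℝ) :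
    A *ᵥ hotX A b c σ s = b := by
  have h : A *ᵥ (Aᵀ *ᵥ hotY A b c σ s) = σ⁻¹ • b - A *ᵥ (σ⁻¹ • s - c) := by
    rw [hotY, mulVec_mulVec, mulVec_mulVec, mul_nonsing_inv _ hA, one_mulVec]
  rw [hotX, mulVec_add, mulVec_smul, mulVec_sub, h]
  ext r
  simp only [mulVec_sub, mulVec_smul, Pi.add_apply, Pi.sub_apply, Pi.smul_apply, smul_eq_mul]
  field_simp
  ring

theorem sum_sq_hotReflect_sub_le (hA : IsUnit (A * Aᵀ).det) (hσ : 0 < σ) (s t : C → ℝ) :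
    ∑ i, (hotReflect A b c σ s i - hotReflect A b c σ t i) ^ 2 ≤ ∑ i, (s i - t i) ^ 2 := by
  set d := hotX A b c σ s - hotX A b c σ t with hd
  have hAd : A *ᵥ d = 0 := by
    rw [hd, mulVec_sub, mulVec_hotX hA hσ, mulVec_hotX hA hσ, sub_self]
  have hrange : (s - t) - d = Aᵀ *ᵥ (σ • (hotY A b c σ t - hotY A b c σ s)) := by
    rw [hd, hotX, hotX, mulVec_smul, mulVec_sub]
    module
  have horth : d ⬝ᵥ ((s - t) - d) = 0 := by
    rw [hrange, mulVec_transpose, dotProduct_comm, ← dotProduct_mulVec, hAd, dotProduct_zero]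
  calc ∑ i, (hotReflect A b c σ s i - hotReflect A b c σ t i) ^ 2
      ≤ ∑ i, (2 * d i - (s i - t i)) ^ 2 := by
        refine sum_le_sum fun i _ => sq_le_sq.2 ((abs_abs_sub_abs_le_abs_sub _ _).trans_eq ?_)
        congr 1
        simp only [hd, Pi.sub_apply]
        ring
    _ = ∑ i, (s i - t i) ^ 2 - 4 * (d ⬝ᵥ ((s - t) - d)) := by
        rw [dotProduct, mul_sum, ← sum_sub_distrib]
        refine sum_congr rfl fun i _ => ?_
        simp only [Pi.sub_apply]
        ring
    _ = ∑ i, (s i - t i) ^ 2 := by rw [horth]; ring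

theorem hotReflect_eq_self_of_kkt (hA : IsUnit (A * Aᵀ).det) (hσ : 0 < σ)
    {y : R → ℝ} {z x : C → ℝ} (hd : Aᵀ *ᵥ y + z = c) (hp : A *ᵥ x = b)
    (hx : ∀ i, 0 ≤ x i) (hz : ∀ i, 0 ≤ z i) (hxz : ∀ i, x i = 0 ∨ z i = 0) :
    hotReflect A b c σ (x + σ • z) = x + σ • z := by
  have hY : hotY A b c σ (x + σ • z) = y := by
    have e : σ⁻¹ • b - A *ᵥ (σ⁻¹ • (x + σ • z) - c) = (A * Aᵀ) *ᵥ y := by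
      rw [← hd, ← hp, smul_add, inv_smul_smul₀ hσ.ne', ← mulVec_mulVec, ← mulVec_smul,
        ← mulVec_sub]
      congr 1
      module
    rw [hotY, e, mulVec_mulVec, nonsing_inv_mul _ hA, one_mulVec]
  have hX : hotX A b c σ (x + σ • z) = x := by
    rw [hotX, hY, ← hd]
    module
  ext i
  simp only [hotReflect, hX, Pi.add_apply, Pi.smul_apply, smul_eq_mul]
  rcases hxz i with h | h
  · have := mul_nonneg hσ.le (hz i)
    rw [h, abs_of_nonpos (by linarith)]
    ring
  · rw [h, abs_of_nonneg (by linarith [hx i])]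
    ring

theorem lipschitzWith_hotReflect (hA : IsUnit (A * Aᵀ).det) (hσ : 0 < σ) :
    LipschitzWith 1 fun v : EuclideanSpace ℝ C =>
      WithLp.toLp 2 (hotReflect A b c σ (WithLp.ofLp v)) := by
  refine LipschitzWith.of_dist_le_mul fun v w => ?_
  rw [NNReal.coe_one, one_mul, EuclideanSpace.dist_eq, EuclideanSpace.dist_eq]
  refine Real.sqrt_le_sqrt ?_
  simpa only [Real.dist_eq, sq_abs] using sum_sq_hotReflect_sub_le hA hσ _ _

theorem hotReflect_halpern_tendsto (hA : IsUnit (A * Aᵀ).det) (hσ : 0 < σ)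
    (hfix : ∃ p, hotReflect A b c σ p = p) {s : ℕ → C → ℝ}
    (hs : ∀ k : ℕ, s (k + 1) =
      (1 / ((k : ℝ) + 2)) • s 0 + (((k : ℝ) + 1) / ((k : ℝ) + 2)) • hotReflect A b c σ (s k)) :
    ∃ p, hotReflect A b c σ p = p ∧ Tendsto s atTop (𝓝 p) := by
  obtain ⟨p₀, hp₀⟩ := hfix
  obtain ⟨p, hp, hlim⟩ := halpern_tendsto (s := fun k => WithLp.toLp 2 (s k))
    (lipschitzWith_hotReflect (A := A) (b := b) (c := c) hA hσ)
    (fun k => by rw [hs k]; rfl) ⟨WithLp.toLp 2 p₀, congrArg (WithLp.toLp 2) hp₀⟩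
  exact ⟨WithLp.ofLp p, congrArg WithLp.ofLp hp,
    ((PiLp.continuous_ofLp 2 _).tendsto p).comp hlim⟩

theorem hot_tendsto_kkt (hA : IsUnit (A * Aᵀ).det) (hσ : 0 < σ)
    (hkkt : ∃ y z x, Aᵀ *ᵥ y + z = c ∧ A *ᵥ x = b ∧ (∀ i, 0 ≤ x i) ∧ (∀ i, 0 ≤ z i) ∧
      ∀ i, x i = 0 ∨ z i = 0)
    {ybar : ℕ → R → ℝ} {z zbar x xbar : ℕ → C → ℝ}
    (hy : ∀ k, ybar k = (A * Aᵀ)⁻¹ *ᵥ (σ⁻¹ • b - A *ᵥ (σ⁻¹ • x k + z k - c)))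
    (hx : ∀ k, xbar k = x k + σ • (Aᵀ *ᵥ ybar k + z k - c))
    (hz : ∀ k, zbar k = fun i => max (c i - (Aᵀ *ᵥ ybar k) i - xbar k i / σ) 0)
    (hkz : ∀ k : ℕ, z (k + 1) =
      (1 / ((k : ℝ) + 2)) • z 0 + (((k : ℝ) + 1) / ((k : ℝ) + 2)) • ((2 : ℝ) • zbar k - z k))
    (hkx : ∀ k : ℕ, x (k + 1) =
      (1 / ((k : ℝ) + 2)) • x 0 + (((k : ℝ) + 1) / ((k : ℝ) + 2)) • ((2 : ℝ) • xbar k - x k)) :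
    ∃ ystar zstar xstar,
      Tendsto (fun k => (ybar k, zbar k, xbar k)) atTop (𝓝 (ystar, zstar, xstar)) ∧
      Aᵀ *ᵥ ystar + zstar = c ∧ A *ᵥ xstar = b ∧
      (∀ i, 0 ≤ xstar i) ∧ (∀ i, 0 ≤ zstar i) ∧ xstar ⬝ᵥ zstar = 0 := by
  set s : ℕ → C → ℝ := fun k => x k + σ • z k with hs
  have hY : ∀ k, ybar k = hotY A b c σ (s k) := fun k => by
    rw [hy, hotY, hs]
    simp only [smul_add, inv_smul_smul₀ hσ.ne']
  have hX : ∀ k, xbar k = hotX A b c σ (s k) := fun k => by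
    rw [hx, hotX, hs, hY]
    module
  have hZ : ∀ k, zbar k = (2 * σ)⁻¹ •
      (hotReflect A b c σ (s k) + s k - (2 : ℝ) • hotX A b c σ (s k)) := fun k => by
    ext i
    have e : c i - (Aᵀ *ᵥ ybar k) i - xbar k i / σ = (s k i - 2 * xbar k i) / σ := by
      have := congrFun (hx k) i
      simp only [Pi.add_apply, Pi.sub_apply, Pi.smul_apply, smul_eq_mul] at this
      simp only [hs, Pi.add_apply, Pi.smul_apply, smul_eq_mul]
      rw [eq_div_iff hσ.ne', sub_mul, div_mul_cancel₀ _ hσ.ne']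
      linear_combination this
    rw [hz]
    simp only [e]
    simp only [hX, hotReflect, Pi.add_apply, Pi.sub_apply, Pi.smul_apply, smul_eq_mul]
    rcases le_total (2 * hotX A b c σ (s k) i - s k i) 0 with h | h
    · rw [abs_of_nonpos h, max_eq_left (div_nonneg (by linarith) hσ.le)]
      field_simp
      ring
    · rw [abs_of_nonneg h, max_eq_right (div_nonpos_of_nonpos_of_nonneg (by linarith) hσ.le)]
      ring
  have hrec : ∀ k : ℕ, s (k + 1) = (1 / ((k : ℝ) + 2)) • s 0 +
      (((k : ℝ) + 1) / ((k : ℝ) + 2)) • hotReflect A b c σ (s k) := fun k => by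
    have e : hotReflect A b c σ (s k) = (2 : ℝ) • (xbar k + σ • zbar k) - s k := by
      rw [hX, hZ]
      match_scalars <;> field_simp <;> ring
    rw [e]
    simp only [hs, hkx, hkz]
    module
  obtain ⟨y₀, z₀, x₀, h1, h2, h3, h4, h5⟩ := hkkt
  obtain ⟨p, hp, hlim⟩ := hotReflect_halpern_tendsto hA hσ
    ⟨_, hotReflect_eq_self_of_kkt hA hσ h1 h2 h3 h4 h5⟩ hrec
  have hcases : ∀ i, (hotX A b c σ p i = p i ∧ 0 ≤ p i) ∨ (hotX A b c σ p i = 0 ∧ 0 ≤ p i) := by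
    intro i
    have hi : |2 * hotX A b c σ p i - p i| = p i := congrFun hp i
    have h0 : 0 ≤ p i := hi ▸ abs_nonneg _
    rcases (abs_eq h0).1 hi with h | h
    · exact .inl ⟨by linarith, h0⟩
    · exact .inr ⟨by linarith, h0⟩
  have hlimY := (continuous_hotY (A := A) (b := b) (c := c) (σ := σ)).tendsto p |>.comp hlim
  have hlimX := (continuous_hotX (A := A) (b := b) (c := c) (σ := σ)).tendsto p |>.comp hlim
  have hcontR : Continuous (hotReflect A b c σ) := by
    have := continuous_hotX (A := A) (b := b) (c := c) (σ := σ)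
    unfold hotReflect
    fun_prop
  have hlimZ : Tendsto zbar atTop (𝓝 (σ⁻¹ • (p - hotX A b c σ p))) := by
    have h := ((((hcontR.tendsto p).comp hlim).add hlim).sub
      (hlimX.const_smul (2 : ℝ))).const_smul (2 * σ)⁻¹
    have e : (2 * σ)⁻¹ • (hotReflect A b c σ p + p - (2 : ℝ) • hotX A b c σ p) =
        σ⁻¹ • (p - hotX A b c σ p) := by
      rw [hp]
      match_scalars <;> field_simp
      norm_num
    rw [funext hZ, ← e]
    exact h
  refine ⟨hotY A b c σ p, σ⁻¹ • (p - hotX A b c σ p), hotX A b c σ p, ?_, ?_,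
    mulVec_hotX hA hσ p, fun i => ?_, fun i => ?_, ?_⟩
  · rw [funext hY, funext hX]
    exact hlimY.prodMk_nhds (hlimZ.prodMk_nhds hlimX)
  · rw [hotX]
    match_scalars <;> field_simp <;> ring
  · rcases hcases i with h | h <;> simp [h.1, h.2]
  · rcases hcases i with h | h <;> simp [h.1, h.2, hσ.le, mul_nonneg, inv_nonneg]
  · refine sum_eq_zero fun i _ => ?_
    rcases hcases i with h | h <;> simp [h.1]

end HOT

theorem kkt_primal_le {R C : Type*} [Fintype R] [Fintype C] {A : Matrix R C ℝ} {b y : R → ℝ}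
    {c z x x' : C → ℝ} (hd : Aᵀ *ᵥ y + z = c) (hp : A *ᵥ x = b) (hz : ∀ i, 0 ≤ z i)
    (hxz : x ⬝ᵥ z = 0) (hp' : A *ᵥ x' = b) (hx' : ∀ i, 0 ≤ x' i) : c ⬝ᵥ x ≤ c ⬝ᵥ x' := by
  have h : 0 ≤ z ⬝ᵥ x' := sum_nonneg fun i _ => mul_nonneg (hz i) (hx' i)
  rw [← hd, add_dotProduct, add_dotProduct, mulVec_transpose, ← dotProduct_mulVec,
    ← dotProduct_mulVec, hp, hp', dotProduct_comm z x, hxz]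
  linarith

theorem kkt_dual_le {R C : Type*} [Fintype R] [Fintype C] {A : Matrix R C ℝ} {b y y' : R → ℝ}
    {c z z' x : C → ℝ} (hd : Aᵀ *ᵥ y + z = c) (hp : A *ᵥ x = b) (hx : ∀ i, 0 ≤ x i)
    (hxz : x ⬝ᵥ z = 0) (hd' : Aᵀ *ᵥ y' + z' = c) (hz' : ∀ i, 0 ≤ z' i) :
    -(b ⬝ᵥ y) ≤ -(b ⬝ᵥ y') := by
  have h : 0 ≤ x ⬝ᵥ z' := sum_nonneg fun i _ => mul_nonneg (hx i) (hz' i)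
  have key : ∀ u, b ⬝ᵥ u = x ⬝ᵥ (Aᵀ *ᵥ u) := fun u => by
    rw [← hp, mulVec_transpose, dotProduct_comm, dotProduct_mulVec, dotProduct_comm]
  rw [key, key, eq_sub_of_add_eq hd, eq_sub_of_add_eq hd', dotProduct_sub, dotProduct_sub, hxz]
  linarith

theorem isUnit_det_mul_transpose {R C : Type*} [Fintype R] [Fintype C] [DecidableEq R]
    {A : Matrix R C ℝ} (h : ∀ y, Aᵀ *ᵥ y = 0 → y = 0) : IsUnit (A * Aᵀ).det := by
  rw [isUnit_iff_ne_zero]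
  intro hdet
  obtain ⟨y, hy0, hy⟩ := exists_mulVec_eq_zero_iff.2 hdet
  refine hy0 (h y (dotProduct_self_eq_zero.1 ?_))
  rw [dotProduct_mulVec, vecMul_transpose, mulVec_mulVec, hy, zero_dotProduct]

section ReducedOT

variable {m n : ℕ} (hm : 0 < m)

theorem rowIdx_injective : Function.Injective (rowIdx m n hm) := fun r s h => by
  simp only [rowIdx, Prod.mk.injEq, Fin.mk.injEq] at h
  ext
  rw [← Nat.div_add_mod r.1 m, ← Nat.div_add_mod s.1 m, h.1, h.2]

theorem rowIdx_ne_last (hn : 0 < n) (r : Fin (n * m - 1)) :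
    rowIdx m n hm r ≠ (⟨n - 1, Nat.sub_lt hn one_pos⟩, ⟨m - 1, Nat.sub_lt hm one_pos⟩) := by
  intro h
  simp only [rowIdx, Prod.mk.injEq, Fin.mk.injEq] at h
  have h1 := Nat.div_add_mod r.1 m
  have h2 := r.2
  obtain ⟨n, rfl⟩ := Nat.exists_eq_succ_of_ne_zero hn.ne'
  rw [h.1, h.2] at h1
  have h3 : (n + 1) * m = m * n + m := by ring
  simp only [Nat.succ_eq_add_one, Nat.add_sub_cancel] at h1 h2
  omega

theorem Amat_transpose_mulVec_inl
    (y : (Fin n × Fin m) ⊕ (Fin n × Fin m) ⊕ Fin (n * m - 1) → ℝ) (j : Fin n) (k i : Fin m) :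
    ((Amat m n hm)ᵀ *ᵥ y) (.inl (j, k, i)) = y (.inl (j, k)) + y (.inr (.inl (j, i))) := by
  have h (q p : Fin n × Fin m) : (p.1 = q.1 ∧ p.2 = q.2) ↔ p = q := Prod.ext_iff.symm
  simp [mulVec, dotProduct, Amat, h (j, k), h (j, i)]

theorem Amat_transpose_mulVec_inr
    (y : (Fin n × Fin m) ⊕ (Fin n × Fin m) ⊕ Fin (n * m - 1) → ℝ) (l j : Fin n) (k : Fin m) :
    ((Amat m n hm)ᵀ *ᵥ y) (.inr (l, j, k)) =
      -y (.inl (j, k)) + ∑ r, if rowIdx m n hm r = (l, k) then y (.inr (.inr r)) else 0 := by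
  have h (q p : Fin n × Fin m) : (p.1 = q.1 ∧ p.2 = q.2) ↔ p = q := Prod.ext_iff.symm
  simp [mulVec, dotProduct, Amat, h (j, k), h (l, k)]

theorem Amat_mulVec_inl (x : (Fin n × Fin m × Fin m) ⊕ (Fin n × Fin n × Fin m) → ℝ)
    (j : Fin n) (k : Fin m) :
    (Amat m n hm *ᵥ x) (.inl (j, k)) = ∑ i, x (.inl (j, k, i)) - ∑ l, x (.inr (l, j, k)) := by
  simp only [mulVec, dotProduct, Amat, of_apply, Fintype.sum_sum_type, Fintype.sum_prod_type,
    ite_and, ite_mul, one_mul, neg_mul, zero_mul, sub_eq_add_neg]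
  congr 1
  · simp only [sum_ite_irrel, sum_const_zero, sum_ite_eq, mem_univ, if_true]
    rw [sum_comm]
    simp
  · simp

theorem Amat_mulVec_inr_inl (x : (Fin n × Fin m × Fin m) ⊕ (Fin n × Fin n × Fin m) → ℝ)
    (j : Fin n) (i : Fin m) :
    (Amat m n hm *ᵥ x) (.inr (.inl (j, i))) = ∑ k, x (.inl (j, k, i)) := by
  simp [mulVec, dotProduct, Amat, Fintype.sum_prod_type, ite_and]

theorem Amat_mulVec_inr_inr (x : (Fin n × Fin m × Fin m) ⊕ (Fin n × Fin n × Fin m) → ℝ)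
    (r : Fin (n * m - 1)) :
    (Amat m n hm *ᵥ x) (.inr (.inr r)) =
      ∑ j, x (.inr ((rowIdx m n hm r).1, j, (rowIdx m n hm r).2)) := by
  simp [mulVec, dotProduct, Amat, Fintype.sum_prod_type, ite_and]

theorem Amat_transpose_mulVec_injective (hn : 0 < n)
    (y : (Fin n × Fin m) ⊕ (Fin n × Fin m) ⊕ Fin (n * m - 1) → ℝ)
    (hy : (Amat m n hm)ᵀ *ᵥ y = 0) : y = 0 := by
  have h1 (j : Fin n) (k i : Fin m) : y (.inl (j, k)) + y (.inr (.inl (j, i))) = 0 := by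
    rw [← Amat_transpose_mulVec_inl hm, hy]; rfl
  have h2 (l j : Fin n) (k : Fin m) : -y (.inl (j, k)) +
      ∑ r, (if rowIdx m n hm r = (l, k) then y (.inr (.inr r)) else 0) = 0 := by
    rw [← Amat_transpose_mulVec_inr hm, hy]; rfl
  have hu_last (j : Fin n) : y (.inl (j, ⟨m - 1, Nat.sub_lt hm one_pos⟩)) = 0 := by
    have := h2 ⟨n - 1, Nat.sub_lt hn one_pos⟩ j ⟨m - 1, Nat.sub_lt hm one_pos⟩
    simpa [rowIdx_ne_last hm hn] using this
  have hv (j : Fin n) (i : Fin m) : y (.inr (.inl (j, i))) = 0 := by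
    linarith [h1 j ⟨m - 1, Nat.sub_lt hm one_pos⟩ i, hu_last j]
  have hu (j : Fin n) (k : Fin m) : y (.inl (j, k)) = 0 := by
    linarith [h1 j k k, hv j k]
  ext (⟨j, k⟩ | ⟨j, i⟩ | r)
  · exact hu j k
  · exact hv j i
  · have := h2 (rowIdx m n hm r).1 (rowIdx m n hm r).1 (rowIdx m n hm r).2
    simpa [hu, (rowIdx_injective hm).eq_iff] using this

theorem exists_Amat_transpose_mulVec_eq_one :
    ∃ v, (Amat m n hm)ᵀ *ᵥ v = 1 := by
  refine ⟨Sum.elim (fun _ => -1) (Sum.elim (fun _ => 2) fun _ => 0), ?_⟩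
  ext (⟨j, k, i⟩ | ⟨l, j, k⟩)
  · rw [Amat_transpose_mulVec_inl]; norm_num
  · rw [Amat_transpose_mulVec_inr]; simp

theorem exists_feasible_transport {μ1 μ2 : Fin n × Fin m → ℝ}
    (hμ1 : ∀ p, 0 ≤ μ1 p) (hμ2 : ∀ p, 0 ≤ μ2 p) (hs1 : ∑ p, μ1 p = 1) (hs2 : ∑ p, μ2 p = 1) :
    ∃ x, Amat m n hm *ᵥ x = bvec m n hm μ1 μ2 ∧ ∀ i, 0 ≤ x i := by
  -- the flows induced by the product coupling of `μ1` and `μ2`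
  refine ⟨Sum.elim (fun q => μ1 (q.1, q.2.2) * ∑ l, μ2 (l, q.2.1))
    (fun q => (∑ i, μ1 (q.2.1, i)) * μ2 (q.1, q.2.2)), ?_, ?_⟩
  · ext (⟨j, k⟩ | ⟨j, i⟩ | r)
    · rw [Amat_mulVec_inl]
      simp [bvec, ← sum_mul, ← mul_sum]
    · rw [Amat_mulVec_inr_inl]
      simp only [Sum.elim_inl, bvec, Sum.elim_inr]
      rw [← mul_sum, sum_comm, ← Fintype.sum_prod_type (fun p => μ2 p), hs2, mul_one]
    · rw [Amat_mulVec_inr_inr]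
      simp only [Sum.elim_inr, bvec]
      rw [← sum_mul, ← Fintype.sum_prod_type (fun p => μ1 p), hs1, one_mul]
  · rintro (q | q)
    · exact mul_nonneg (hμ1 _) (sum_nonneg fun l _ => hμ2 _)
    · exact mul_nonneg (sum_nonneg fun i _ => hμ1 _) (hμ2 _)

end ReducedOT

/-- Proposition 2 of the paper: global convergence of HOT.
The sequence `{w̄ᵏ} = {(ȳᵏ, z̄ᵏ, x̄ᵏ)}` generated by the HOT iteration converges to a
point `w* = (y*, z*, x*)` satisfying the KKT conditions; in particular `x*` is optimal
for the primal LP `min {⟨c,x⟩ : A x = b, x ≥ 0}` and `(y*, z*)` is optimal for the dual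
LP `min {−⟨b,y⟩ : Aᵀ y + z = c, z ≥ 0}`. -/
theorem stmt9 (m n : ℕ) (hm : 0 < m) (hn : 0 < n)
    (μ1 μ2 : Fin n × Fin m → ℝ)
    (hμ1 : ∀ p, 0 ≤ μ1 p) (hμ2 : ∀ p, 0 ≤ μ2 p)
    (hs1 : ∑ p, μ1 p = 1) (hs2 : ∑ p, μ2 p = 1)
    (σ : ℝ) (hσ : 0 < σ)
    (y ybar : ℕ → ((Fin n × Fin m) ⊕ (Fin n × Fin m) ⊕ Fin (n * m - 1)) → ℝ)
    (z zbar x xbar : ℕ → ((Fin n × Fin m × Fin m) ⊕ (Fin n × Fin n × Fin m)) → ℝ)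
    -- Step 1:  ȳᵏ = (A Aᵀ)⁻¹ ( b/σ − A (xᵏ/σ + zᵏ − c) )
    (hy : ∀ k, ybar k = (Amat m n hm * (Amat m n hm)ᵀ)⁻¹.mulVec
      (σ⁻¹ • bvec m n hm μ1 μ2 -
        (Amat m n hm).mulVec (σ⁻¹ • x k + z k - cvec m n)))
    -- Step 2:  x̄ᵏ = xᵏ + σ (Aᵀ ȳᵏ + zᵏ − c)
    (hx : ∀ k, xbar k = x k + σ • ((Amat m n hm)ᵀ.mulVec (ybar k) + z k - cvec m n))
    -- Step 3:  z̄ᵏ = Π_{ℝ₊}( c − Aᵀ ȳᵏ − x̄ᵏ/σ )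
    (hz : ∀ k, zbar k = fun i =>
      max (cvec m n i - (Amat m n hm)ᵀ.mulVec (ybar k) i - xbar k i / σ) 0)
    -- Step 4 (Halpern step):  wᵏ⁺¹ = (1/(k+2)) w⁰ + ((k+1)/(k+2)) (2 w̄ᵏ − wᵏ)
    (hky : ∀ k, y (k + 1) =
      (1 / ((k : ℝ) + 2)) • y 0 + (((k : ℝ) + 1) / ((k : ℝ) + 2)) • ((2 : ℝ) • ybar k - y k))
    (hkz : ∀ k, z (k + 1) =
      (1 / ((k : ℝ) + 2)) • z 0 + (((k : ℝ) + 1) / ((k : ℝ) + 2)) • ((2 : ℝ) • zbar k - z k))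
    (hkx : ∀ k, x (k + 1) =
      (1 / ((k : ℝ) + 2)) • x 0 + (((k : ℝ) + 1) / ((k : ℝ) + 2)) • ((2 : ℝ) • xbar k - x k)) :
    ∃ ystar zstar xstar,
      Tendsto (fun k => (ybar k, zbar k, xbar k)) atTop (𝓝 (ystar, zstar, xstar)) ∧
      (Amat m n hm)ᵀ.mulVec ystar + zstar = cvec m n ∧
      (Amat m n hm).mulVec xstar = bvec m n hm μ1 μ2 ∧
      (∀ i, 0 ≤ xstar i) ∧ (∀ i, 0 ≤ zstar i) ∧ xstar ⬝ᵥ zstar = 0 ∧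
      (∀ x', (Amat m n hm).mulVec x' = bvec m n hm μ1 μ2 → (∀ i, 0 ≤ x' i) →
        cvec m n ⬝ᵥ xstar ≤ cvec m n ⬝ᵥ x') ∧
      (∀ y' z', (Amat m n hm)ᵀ.mulVec y' + z' = cvec m n → (∀ i, 0 ≤ z' i) →
        -(bvec m n hm μ1 μ2 ⬝ᵥ ystar) ≤ -(bvec m n hm μ1 μ2 ⬝ᵥ y')) := by
  obtain ⟨ystar, zstar, xstar, hlim, hd, hp, hx0, hz0, hxz⟩ := hot_tendsto_kkt
    (isUnit_det_mul_transpose (Amat_transpose_mulVec_injective hm hn)) hσ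
    (exists_kkt _ _ _ (exists_feasible_transport hm hμ1 hμ2 hs1 hs2)
      (exists_Amat_transpose_mulVec_eq_one hm)) hy hx hz hkz hkx
  exact ⟨ystar, zstar, xstar, hlim, hd, hp, hx0, hz0, hxz,
    fun _ hp' hx' => kkt_primal_le hd hp hz0 hxz hp' hx',
    fun _ _ hd' hz' => kkt_dual_le hd hp hx0 hxz hd' hz'⟩
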